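/- Let 1 < p < ∞ and let 𝓜 be a prime ideal in the ring M^p containing a function F ∈ M^p with F(z) ≠ 0 for every z ∈ 𝔻 and F not identically zero. Then 𝓜 is dense in the metric space (M^p, ρ_p), i.e., cl(𝓜) = M^p. -/

import Mathlib

open MeasureTheory Filter Set
open scoped ENNReal Topology Real NNReal

noncomputable section

/-- The open unit disk in the complex plane. -/
def unitDisk : Set ℂ := Metric.ball 0 1

/-- The point `r·e^{iθ}`. -/
def circlePt (r θ : ℝ) : ℂ := (r : ℂ) * Complex.exp (θ * Complex.I)

/-- The maximal radial function `Mf(θ) = sup_{0 ≤ r < 1} |f(r e^{iθ})|`, valued in `ℝ≥0∞`. -/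
def maxRad (f : ℂ → ℂ) (θ : ℝ) : ℝ≥0∞ :=
  ⨆ r ∈ Set.Ico (0 : ℝ) 1, (‖f (circlePt r θ)‖₊ : ℝ≥0∞)

/-- `log⁺` on `ℝ≥0∞`. -/
def elogPlus (x : ℝ≥0∞) : ℝ≥0∞ :=
  if x = ∞ then ∞ else ENNReal.ofReal (Real.log x.toReal)

/-- `x ↦ log (1 + x)` on `ℝ≥0∞`. -/
def elog1p (x : ℝ≥0∞) : ℝ≥0∞ :=
  if x = ∞ then ∞ else ENNReal.ofReal (Real.log (1 + x.toReal))

/-- The radial boundary value `f*(e^{iθ}) = lim_{r→1⁻} f(r e^{iθ})`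
(a junk value is returned where the limit does not exist). -/
def radialLimit (f : ℂ → ℂ) (θ : ℝ) : ℂ :=
  limUnder (nhdsWithin (1 : ℝ) (Set.Iio 1)) fun r : ℝ => f (circlePt r θ)

/-- The class `M^p`: holomorphic functions on the unit disk with
`∫₀^{2π} (log⁺ Mf(θ))^p dθ/2π < ∞`. -/
def MpClass (p : ℝ) : Set (ℂ → ℂ) :=
  {f | DifferentiableOn ℂ f unitDisk ∧
    (∫⁻ θ in Set.Ioc 0 (2 * π), elogPlus (maxRad f θ) ^ p) / ENNReal.ofReal (2 * π) < ∞}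

/-- The metric `ρ_p` on `M^p`. -/
def rhoMetric (p : ℝ) (f g : ℂ → ℂ) : ℝ≥0∞ :=
  ((∫⁻ θ in Set.Ioc 0 (2 * π), elog1p (maxRad (f - g) θ) ^ p) /
    ENNReal.ofReal (2 * π)) ^ (1 / p)

/-- The Privalov class `N^p`: holomorphic functions on the unit disk with
`sup_{0≤r<1} ∫₀^{2π} (log⁺|f(re^{iθ})|)^p dθ/2π < ∞`. -/
def NpClass (p : ℝ) : Set (ℂ → ℂ) :=
  {f | DifferentiableOn ℂ f unitDisk ∧
    (⨆ r ∈ Set.Ico (0 : ℝ) 1,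
      (∫⁻ θ in Set.Ioc 0 (2 * π),
        ENNReal.ofReal (Real.log ‖f (circlePt r θ)‖) ^ p) / ENNReal.ofReal (2 * π)) < ∞}

/-- The metric `d_p` on `N^p`, defined via boundary values. -/
def dMetric (p : ℝ) (f g : ℂ → ℂ) : ℝ≥0∞ :=
  ((∫⁻ θ in Set.Ioc 0 (2 * π),
      ENNReal.ofReal (Real.log (1 + ‖radialLimit f θ - radialLimit g θ‖)) ^ p) /
    ENNReal.ofReal (2 * π)) ^ (1 / p)

/-- The Hardy space `H^p`. -/
def HpClass (p : ℝ) : Set (ℂ → ℂ) :=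
  {f | DifferentiableOn ℂ f unitDisk ∧
    (⨆ r ∈ Set.Ico (0 : ℝ) 1,
      (∫⁻ θ in Set.Ioc 0 (2 * π), (‖f (circlePt r θ)‖₊ : ℝ≥0∞) ^ p) /
        ENNReal.ofReal (2 * π)) < ∞}

/-- The Smirnov class `N⁺`. -/
def SmirnovClass : Set (ℂ → ℂ) :=
  {f | DifferentiableOn ℂ f unitDisk ∧
    (∫⁻ θ in Set.Ioc 0 (2 * π), ENNReal.ofReal (Real.log ‖radialLimit f θ‖)) /
      ENNReal.ofReal (2 * π) < ∞ ∧
    Tendsto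
      (fun r : ℝ => (∫⁻ θ in Set.Ioc 0 (2 * π),
        ENNReal.ofReal (Real.log ‖f (circlePt r θ)‖)) / ENNReal.ofReal (2 * π))
      (nhdsWithin (1 : ℝ) (Set.Iio 1))
      (nhds ((∫⁻ θ in Set.Ioc 0 (2 * π),
        ENNReal.ofReal (Real.log ‖radialLimit f θ‖)) / ENNReal.ofReal (2 * π)))}

/-- The normalized Blaschke factor `(|a|/a)·(a − z)/(1 − conj a · z)`. -/
def blaschkeFactor (a z : ℂ) : ℂ :=
  ((‖a‖ : ℂ) / a) * ((a - z) / (1 - (starRingEnd ℂ) a * z))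

/-- `B` is a (finite or infinite) Blaschke product on the unit disk. -/
def IsBlaschkeProduct (B : ℂ → ℂ) : Prop :=
  ∃ m : ℕ,
    (∃ n : ℕ, ∃ a : ℕ → ℂ, (∀ k < n, a k ∈ unitDisk ∧ a k ≠ 0) ∧
      ∀ z ∈ unitDisk, B z = z ^ m * ∏ k ∈ Finset.range n, blaschkeFactor (a k) z) ∨
    (∃ a : ℕ → ℂ, (∀ k, a k ∈ unitDisk ∧ a k ≠ 0) ∧ (Summable fun k => 1 - ‖a k‖) ∧
      ∀ z ∈ unitDisk, B z = z ^ m * ∏' k, blaschkeFactor (a k) z)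

/-- `I` is an ideal of the ring `M^p`. -/
structure IsIdealIn (p : ℝ) (I : Set (ℂ → ℂ)) : Prop where
  subset : I ⊆ MpClass p
  zero_mem : (0 : ℂ → ℂ) ∈ I
  add_mem : ∀ f ∈ I, ∀ g ∈ I, f + g ∈ I
  neg_mem : ∀ f ∈ I, -f ∈ I
  mul_mem : ∀ f ∈ MpClass p, ∀ g ∈ I, f * g ∈ I

/-- `I` is a prime ideal of the ring `M^p`: an ideal such that whenever a product of two
elements of `M^p` lies in `I`, one of the factors lies in `I`. -/
def IsPrimeIdealIn (p : ℝ) (I : Set (ℂ → ℂ)) : Prop :=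
  IsIdealIn p I ∧ ∀ f ∈ MpClass p, ∀ g ∈ MpClass p, f * g ∈ I → f ∈ I ∨ g ∈ I

/-- `I` is a dense subset of the metric space `(M^p, ρ_p)`. -/
def IsDenseIn (p : ℝ) (I : Set (ℂ → ℂ)) : Prop :=
  ∀ f ∈ MpClass p, ∀ ε : ℝ≥0∞, 0 < ε → ∃ g ∈ I, rhoMetric p f g < ε

/-- `I` is an ideal of the ring `N^p`. -/
structure IsIdealInNp (p : ℝ) (I : Set (ℂ → ℂ)) : Prop where
  subset : I ⊆ NpClass p
  zero_mem : (0 : ℂ → ℂ) ∈ I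
  add_mem : ∀ f ∈ I, ∀ g ∈ I, f + g ∈ I
  neg_mem : ∀ f ∈ I, -f ∈ I
  mul_mem : ∀ f ∈ NpClass p, ∀ g ∈ I, f * g ∈ I

/-- `I` is a prime ideal of the ring `N^p`. -/
def IsPrimeIdealInNp (p : ℝ) (I : Set (ℂ → ℂ)) : Prop :=
  IsIdealInNp p I ∧ ∀ f ∈ NpClass p, ∀ g ∈ NpClass p, f * g ∈ I → f ∈ I ∨ g ∈ I

/-- `I` is a dense subset of the metric space `(N^p, d_p)`. -/
def IsDenseInNp (p : ℝ) (I : Set (ℂ → ℂ)) : Prop :=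
  ∀ f ∈ NpClass p, ∀ ε : ℝ≥0∞, 0 < ε → ∃ g ∈ I, dMetric p f g < ε


/-- Hardy-Littlewood weak type bound. -/
lemma hl_weak (f : ℝ → ℝ≥0∞) (S : Set ℝ) (R : ℝ) (L : ℝ≥0∞)
    (h : ∀ x ∈ S, ∃ r, 0 < r ∧ r ≤ R ∧ L * ENNReal.ofReal r ≤ ∫⁻ t in Metric.closedBall x r, f t) :
    L * volume S ≤ 10 * ∫⁻ t, f t := by
  choose! r hr0 hrR hr using h
  obtain ⟨u, huS, hdisj, hcov⟩ :=
    Vitali.exists_disjoint_subfamily_covering_enlargement_closedBall S (fun x : ℝ => x) r R hrR 5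
      (by norm_num)
  have hucount : u.Countable := by
    refine hdisj.countable_of_nonempty_interior ?_
    intro x hx
    rw [interior_closedBall _ (hr0 x (huS hx)).ne']
    exact Metric.nonempty_ball.2 (hr0 x (huS hx))
  have h1 : volume S ≤ ∑' x : u, volume (Metric.closedBall (x : ℝ) (5 * r x)) := by
    have := hucount.to_subtype
    refine (measure_mono ?_).trans (measure_iUnion_le _)
    intro x hx
    obtain ⟨b, hb, hsub⟩ := hcov x hx
    exact mem_iUnion.2 ⟨⟨b, hb⟩, hsub (Metric.mem_closedBall_self (hr0 x hx).le)⟩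
  calc L * volume S ≤ L * ∑' x : u, volume (Metric.closedBall (x : ℝ) (5 * r x)) := by gcongr
    _ = ∑' x : u, 10 * (L * ENNReal.ofReal (r x)) := by
      rw [← ENNReal.tsum_mul_left]
      congr 1; ext x
      rw [Real.volume_closedBall, show 2 * (5 * r x) = 10 * r x by ring,
        ENNReal.ofReal_mul (by norm_num)]
      simp only [ENNReal.ofReal_ofNat]
      ring
    _ = 10 * ∑' x : u, (L * ENNReal.ofReal (r x)) := by rw [ENNReal.tsum_mul_left]
    _ ≤ 10 * ∑' x : u, ∫⁻ t in Metric.closedBall (x : ℝ) (r x), f t := by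
      gcongr with x
      exact hr x (huS x.2)
    _ = 10 * ∫⁻ t in ⋃ x ∈ u, Metric.closedBall (x : ℝ) (r x), f t := by
      rw [lintegral_biUnion hucount (fun x _ => Metric.isClosed_closedBall.measurableSet) hdisj]
    _ ≤ 10 * ∫⁻ t, f t := by
      gcongr
      exact Measure.restrict_le_self

/-- Lower bound for `|e^{it} - r e^{iθ}|`. -/
lemma dist_lower (r θ t : ℝ) (hr0 : 0 ≤ r) (hr1 : r < 1) (ht : |t - θ| ≤ π) :
    1 - r ≤ ‖circleMap 0 1 t - circlePt r θ‖ ∧ |t - θ| ≤ π * ‖circleMap 0 1 t - circlePt r θ‖ := by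
  have e1 : ‖circleMap 0 1 t‖ = 1 := by simp
  have e2 : ‖circlePt r θ‖ = r := by
    simp [circlePt, Complex.norm_exp_ofReal_mul_I, abs_of_nonneg hr0]
  have h1 : 1 - r ≤ ‖circleMap 0 1 t - circlePt r θ‖ := by
    have := norm_sub_norm_le (circleMap 0 1 t) (circlePt r θ)
    rw [e1, e2] at this; exact this
  refine ⟨h1, ?_⟩
  have h2 : ‖circleMap 0 1 t - circleMap 0 1 θ‖ ≤ 2 * ‖circleMap 0 1 t - circlePt r θ‖ := by
    have h3 : ‖circlePt r θ - circleMap 0 1 θ‖ = 1 - r := by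
      have : circlePt r θ - circleMap 0 1 θ = ((r - 1 : ℝ) : ℂ) * Complex.exp (θ * Complex.I) := by
        simp [circlePt, circleMap]; ring
      rw [this, norm_mul, Complex.norm_exp_ofReal_mul_I, Complex.norm_real, Real.norm_eq_abs,
        abs_of_nonpos (by linarith)]; ring
    have := norm_sub_le_norm_sub_add_norm_sub (circleMap 0 1 t) (circlePt r θ) (circleMap 0 1 θ)
    linarith
  have h4 : ‖circleMap 0 1 t - circleMap 0 1 θ‖ = 2 * |Real.sin ((t - θ) / 2)| := by
    have : circleMap 0 1 t - circleMap 0 1 θ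
        = Complex.exp (θ * Complex.I) * (Complex.exp (Complex.I * ((t - θ : ℝ) : ℂ)) - 1) := by
      simp only [circleMap, mul_sub, ← Complex.exp_add]
      simp
      congr 1; ring
    rw [this, norm_mul, Complex.norm_exp_ofReal_mul_I, Complex.norm_exp_I_mul_ofReal_sub_one]
    simp
  have h5 : 2 / π * |(t - θ) / 2| ≤ |Real.sin ((t - θ) / 2)| := by
    apply Real.mul_abs_le_abs_sin
    rw [abs_div, abs_two]; linarith
  have h6 : |t - θ| / π ≤ ‖circleMap 0 1 t - circlePt r θ‖ := by
    have : 2 / π * |(t - θ) / 2| = |t - θ| / π := by rw [abs_div, abs_two]; ring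
    linarith
  rw [div_le_iff₀ Real.pi_pos] at h6
  linarith

lemma poisson_dyadic (r θ t : ℝ) (hr0 : 0 ≤ r) (hr1 : r < 1) (ht : |t - θ| ≤ π) :
    ENNReal.ofReal (poissonKernel 0 (circlePt r θ) (circleMap 0 1 t)) ≤
      ∑' k : ℕ, ENNReal.ofReal (8 * (1/4) ^ k / (1 - r)) *
        (Metric.closedBall θ (min π (π * (1 - r) * 2 ^ k))).indicator 1 t := by
  obtain ⟨h1, h2⟩ := dist_lower r θ t hr0 hr1 ht
  set D := ‖circleMap 0 1 t - circlePt r θ‖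
  have hδ : 0 < 1 - r := by linarith
  have hD : 0 < D := by linarith
  have hP : poissonKernel 0 (circlePt r θ) (circleMap 0 1 t) ≤ 2 * (1 - r) / D ^ 2 := by
    have e2 : ‖circlePt r θ‖ = r := by
      simp [circlePt, Complex.norm_exp_ofReal_mul_I, abs_of_nonneg hr0]
    rw [poissonKernel_def]
    simp only [sub_zero, norm_circleMap_zero, abs_one, e2]
    change _ / D ^ 2 ≤ _
    gcongr
    nlinarith
  have hex : ∃ k : ℕ, |t - θ| ≤ π * (1 - r) * 2 ^ k := by
    obtain ⟨k, hk⟩ := pow_unbounded_of_one_lt (|t - θ| / (π * (1 - r))) (one_lt_two)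
    refine ⟨k, ?_⟩
    rw [div_lt_iff₀ (by positivity)] at hk
    linarith
  classical
  let k := Nat.find hex
  have hk : |t - θ| ≤ π * (1 - r) * 2 ^ k := Nat.find_spec hex
  refine le_trans ?_ (ENNReal.le_tsum k)
  rw [indicator_of_mem, Pi.one_apply, mul_one]
  · apply ENNReal.ofReal_le_ofReal
    refine hP.trans ?_
    rw [div_le_div_iff₀ (by positivity) hδ]
    rcases Nat.eq_zero_or_pos k with h0 | h0
    · rw [h0]; nlinarith
    · obtain ⟨j, hj⟩ : ∃ j, k = j + 1 := ⟨k - 1, by omega⟩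
      have hlt : ¬ (|t - θ| ≤ π * (1 - r) * 2 ^ j) := Nat.find_min hex (by omega)
      push Not at hlt
      have h3 : (1 - r) * 2 ^ j ≤ D := by
        have : π * ((1 - r) * 2 ^ j) ≤ π * D := by linarith
        exact le_of_mul_le_mul_left this Real.pi_pos
      have h4 : ((1 - r) * 2 ^ j) ^ 2 ≤ D ^ 2 := by gcongr
      have h5 : (1 / 4 : ℝ) ^ j * ((2:ℝ) ^ j) ^ 2 = 1 := by
        rw [← pow_mul, mul_comm j 2, pow_mul, ← mul_pow]; norm_num
      rw [hj, pow_succ]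
      calc 2 * (1 - r) * (1 - r) = 2 * (1/4) ^ j * ((1 - r) * 2 ^ j) ^ 2 := by
            rw [mul_pow]; linear_combination (-2 * (1 - r)^2) * h5
        _ ≤ 2 * (1/4) ^ j * D ^ 2 := by gcongr
        _ = _ := by ring
  · rw [Metric.mem_closedBall, Real.dist_eq, le_min_iff]
    exact ⟨ht, hk⟩

lemma poisson_max (f : ℝ → ℝ≥0∞) (hf : Measurable f) (r θ : ℝ) (hr0 : 0 ≤ r) (hr1 : r < 1)
    (L : ℝ≥0∞)
    (h : ∀ x, 0 < x → x ≤ π → ∫⁻ t in Metric.closedBall θ x, f t ≤ L * ENNReal.ofReal x) :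
    ∫⁻ t in Metric.closedBall θ π,
      ENNReal.ofReal (poissonKernel 0 (circlePt r θ) (circleMap 0 1 t)) * f t
      ≤ ENNReal.ofReal (16 * π) * L := by
  have hδ : 0 < 1 - r := by linarith
  calc _ ≤ ∫⁻ t in Metric.closedBall θ π,
        ∑' k : ℕ, ENNReal.ofReal (8 * (1/4) ^ k / (1 - r)) *
        (Metric.closedBall θ (min π (π * (1 - r) * 2 ^ k))).indicator f t := by
        refine setLIntegral_mono' Metric.isClosed_closedBall.measurableSet ?_
        intro t ht
        rw [Metric.mem_closedBall, Real.dist_eq] at ht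
        refine (mul_le_mul_left (poisson_dyadic r θ t hr0 hr1 ht) _).trans ?_
        rw [← ENNReal.tsum_mul_right]
        refine ENNReal.tsum_le_tsum fun k => ?_
        rw [mul_assoc]
        gcongr
        by_cases h' : t ∈ Metric.closedBall θ (min π (π * (1 - r) * 2 ^ k)) <;> simp [h']
    _ ≤ ∫⁻ t, ∑' k : ℕ, ENNReal.ofReal (8 * (1/4) ^ k / (1 - r)) *
        (Metric.closedBall θ (min π (π * (1 - r) * 2 ^ k))).indicator f t :=
        setLIntegral_le_lintegral _ _
    _ = ∑' k : ℕ, ENNReal.ofReal (8 * (1/4) ^ k / (1 - r)) *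
        ∫⁻ t in Metric.closedBall θ (min π (π * (1 - r) * 2 ^ k)), f t := by
        rw [lintegral_tsum]
        · congr 1; ext k
          rw [lintegral_const_mul _ (hf.indicator Metric.isClosed_closedBall.measurableSet),
            lintegral_indicator Metric.isClosed_closedBall.measurableSet]
        · intro k
          exact ((hf.indicator Metric.isClosed_closedBall.measurableSet).const_mul _).aemeasurable
    _ ≤ ∑' k : ℕ, ENNReal.ofReal (8 * π * (1/2) ^ k) * L := by
        refine ENNReal.tsum_le_tsum fun k => ?_
        have h1 := h (min π (π * (1 - r) * 2 ^ k)) (by positivity) (min_le_left _ _)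
        have h2 : L * ENNReal.ofReal (min π (π * (1 - r) * 2 ^ k)) ≤
          L * ENNReal.ofReal (π * (1 - r) * 2 ^ k) := by
            gcongr; exact min_le_right _ _
        refine (mul_le_mul_right (h1.trans h2) _).trans ?_
        rw [mul_left_comm, ← ENNReal.ofReal_mul (by positivity), mul_comm]
        refine le_of_eq (congrArg (fun x => ENNReal.ofReal x * L) ?_)
        have : (1/2 : ℝ) ^ k = (1/4) ^ k * 2 ^ k := by rw [← mul_pow]; norm_num
        rw [this]; field_simp
    _ = _ := by
        rw [ENNReal.tsum_mul_right, ← ENNReal.ofReal_tsum_of_nonneg]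
        · rw [tsum_mul_left, tsum_geometric_two]; ring_nf
        · intro k; positivity
        · exact summable_geometric_two.mul_left _
lemma norm_circlePt (r θ : ℝ) (hr : 0 ≤ r) : ‖circlePt r θ‖ = r := by
  simp [circlePt, Complex.norm_exp_ofReal_mul_I, abs_of_nonneg hr]

lemma circlePt_mem (r θ : ℝ) (hr : r ∈ Set.Ico (0:ℝ) 1) : circlePt r θ ∈ Metric.ball (0:ℂ) 1 := by
  rw [mem_ball_zero_iff, norm_circlePt r θ hr.1]; exact hr.2

lemma poissonKernel_nonneg_aux (r θ t : ℝ) (hr : r ∈ Set.Ico (0:ℝ) 1) :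
    0 ≤ poissonKernel 0 (circlePt r θ) (circleMap 0 1 t) := by
  rw [poissonKernel_def]
  simp only [sub_zero, norm_circleMap_zero, abs_one, norm_circlePt r θ hr.1]
  have := hr.1
  have := hr.2
  apply div_nonneg _ (by positivity)
  nlinarith

lemma continuous_poisson_aux (r θ : ℝ) (hr : r ∈ Set.Ico (0:ℝ) 1) :
    Continuous fun t => poissonKernel 0 (circlePt r θ) (circleMap 0 1 t) := by
  simp only [poissonKernel_def, sub_zero]
  refine Continuous.div (by fun_prop) (by fun_prop) ?_
  intro t
  have : circleMap 0 1 t - circlePt r θ ≠ 0 := by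
    intro h
    rw [sub_eq_zero] at h
    have h2 := norm_circlePt r θ hr.1
    rw [← h] at h2
    simp at h2
    linarith [hr.2]
  positivity

lemma poisson_repr (v : ℂ → ℂ) (hv : ∀ z ∈ Metric.closedBall (0:ℂ) 1, AnalyticAt ℂ v z)
    (hpos : ∀ z ∈ Metric.closedBall (0:ℂ) 1, 0 ≤ (v z).re) (r θ η : ℝ)
    (hr : r ∈ Set.Ico (0:ℝ) 1) :
    ENNReal.ofReal (v (circlePt r θ)).re * ENNReal.ofReal (2 * π) =
      ∫⁻ t in Metric.closedBall η π,
        ENNReal.ofReal (poissonKernel 0 (circlePt r θ) (circleMap 0 1 t)) *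
          ENNReal.ofReal (v (circleMap 0 1 t)).re := by
  have hmem : ∀ t, circleMap 0 1 t ∈ Metric.closedBall (0:ℂ) 1 := by intro t; simp
  have hharm : InnerProductSpace.HarmonicOnNhd (fun z => (v z).re) (Metric.closedBall (0:ℂ) 1) :=
    fun z hz => (hv z hz).harmonicAt_re
  have h1 := hharm.circleAverage_poissonKernel_smul (circlePt_mem r θ hr)
  rw [Real.circleAverage_def] at h1
  have hcv : Continuous fun t => (v (circleMap 0 1 t)).re := by
    apply Complex.continuous_re.comp
    rw [continuous_iff_continuousAt]
    intro t
    exact ((hv _ (hmem t)).continuousAt).comp (continuous_circleMap 0 1).continuousAt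
  set g : ℝ → ℝ := fun t => poissonKernel 0 (circlePt r θ) (circleMap 0 1 t) *
    (v (circleMap 0 1 t)).re with hg
  have hgc : Continuous g := (continuous_poisson_aux r θ hr).mul hcv
  have hg0 : ∀ t, 0 ≤ g t := fun t =>
    mul_nonneg (poissonKernel_nonneg_aux r θ t hr) (hpos _ (hmem t))
  have hper : g.Periodic (2 * π) := fun t => by
    simp only [hg]; rw [periodic_circleMap 0 1 t]
  have h2 : ∫ t in (0:ℝ)..(2*π), g t = ∫ t in Metric.closedBall η π, g t := by
    have := hper.intervalIntegral_add_eq 0 (η - π)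
    rw [zero_add] at this
    rw [this, intervalIntegral.integral_of_le (by linarith [Real.pi_pos]), Real.closedBall_eq_Icc,
      integral_Icc_eq_integral_Ioc]
    congr 3; ring
  have h3 : (2 * π)⁻¹ * ∫ t in Metric.closedBall η π, g t = (v (circlePt r θ)).re := by
    rw [← h2, ← h1]; rfl
  have h4 : ∫ t in Metric.closedBall η π, g t = (v (circlePt r θ)).re * (2 * π) := by
    rw [← h3]; field_simp
  rw [← ENNReal.ofReal_mul' (by positivity), ← h4, ofReal_integral_eq_lintegral_ofReal]
  · refine lintegral_congr fun t => ?_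
    rw [← ENNReal.ofReal_mul (poissonKernel_nonneg_aux r θ t hr)]
  · exact hgc.continuousOn.integrableOn_compact (isCompact_closedBall _ _)
  · exact ae_of_all _ hg0

lemma re_weak_closed (v : ℂ → ℂ) (hv : ∀ z ∈ Metric.closedBall (0:ℂ) 1, AnalyticAt ℂ v z)
    (hpos : ∀ z ∈ Metric.closedBall (0:ℂ) 1, 0 ≤ (v z).re) (L : ℝ) (hL : 0 < L) :
    ENNReal.ofReal L * volume {θ ∈ Set.Ioc 0 (2 * π) | ∃ r ∈ Set.Ico (0:ℝ) 1,
      8 * L < (v (circlePt r θ)).re} ≤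
      20 * (ENNReal.ofReal (v 0).re * ENNReal.ofReal (2 * π)) := by
  have hmem : ∀ t, circleMap 0 1 t ∈ Metric.closedBall (0:ℂ) 1 := by intro t; simp
  have hcv : Continuous fun t => (v (circleMap 0 1 t)).re := by
    apply Complex.continuous_re.comp
    rw [continuous_iff_continuousAt]
    intro t
    exact ((hv _ (hmem t)).continuousAt).comp (continuous_circleMap 0 1).continuousAt
  set u : ℝ → ℝ≥0∞ := fun t => ENNReal.ofReal (v (circleMap 0 1 t)).re with hu
  have hum : Measurable u := (ENNReal.continuous_ofReal.comp hcv).measurable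
  have hint : ∀ η, ∫⁻ t in Metric.closedBall η π, u t =
      ENNReal.ofReal (v 0).re * ENNReal.ofReal (2 * π) := by
    intro η
    have := poisson_repr v hv hpos 0 0 η (by simp)
    have e : circlePt 0 0 = 0 := by simp [circlePt]
    rw [e] at this
    rw [this]
    refine lintegral_congr fun t => ?_
    simp [poissonKernel_def, hu]
  have key := hl_weak ((Set.Icc (-π) (3 * π)).indicator u) {θ ∈ Set.Ioc 0 (2 * π) |
    ∃ r ∈ Set.Ico (0:ℝ) 1, 8 * L < (v (circlePt r θ)).re} π (ENNReal.ofReal L) ?_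
  · refine key.trans ?_
    rw [lintegral_indicator measurableSet_Icc, show (20 : ℝ≥0∞) = 10 * 2 by norm_num, mul_assoc]
    gcongr
    calc ∫⁻ t in Set.Icc (-π) (3 * π), u t
        ≤ ∫⁻ t in Metric.closedBall 0 π ∪ Metric.closedBall (2 * π) π, u t := by
          apply lintegral_mono_set
          rw [Real.closedBall_eq_Icc, Real.closedBall_eq_Icc]
          intro t ht
          rcases le_total t π with h | h
          · left; exact ⟨by linarith [ht.1], by linarith⟩
          · right; exact ⟨by linarith, by linarith [ht.2]⟩
      _ ≤ _ := lintegral_union_le _ _ _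
      _ = _ := by rw [hint, hint, ← two_mul]
  · rintro θ ⟨hθ, r, hr, hlt⟩
    by_contra! hcon
    have h1 : ∀ x, 0 < x → x ≤ π →
        ∫⁻ t in Metric.closedBall θ x, u t ≤ ENNReal.ofReal L * ENNReal.ofReal x := by
      intro x hx hxπ
      refine le_trans (le_of_eq ?_) (hcon x hx hxπ).le
      refine setLIntegral_congr_fun Metric.isClosed_closedBall.measurableSet ?_
      intro t ht
      rw [Real.closedBall_eq_Icc] at ht
      rw [indicator_of_mem]
      exact ⟨by linarith [ht.1, hθ.1], by linarith [ht.2, hθ.2]⟩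
    have h2 := poisson_max u hum r θ hr.1 hr.2 _ h1
    rw [← poisson_repr v hv hpos r θ θ hr, ← ENNReal.ofReal_mul' (by positivity),
      ← ENNReal.ofReal_mul (by positivity), ENNReal.ofReal_le_ofReal_iff (by positivity)] at h2
    have := Real.pi_pos
    nlinarith

lemma re_ae_bdd (w : ℂ → ℂ) (hw : DifferentiableOn ℂ w (Metric.ball 0 1))
    (hpos : ∀ z ∈ Metric.ball (0:ℂ) 1, 0 ≤ (w z).re) :
    ∀ᵐ θ ∂(volume.restrict (Set.Ioc 0 (2 * π))), ∃ B : ℝ, ∀ r ∈ Set.Ico (0:ℝ) 1,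
      (w (circlePt r θ)).re ≤ B := by
  set C : ℝ≥0∞ := 20 * (ENNReal.ofReal (w 0).re * ENNReal.ofReal (2 * π)) with hC
  have hCtop : C ≠ ∞ := by
    rw [hC]; finiteness
  have hS : ∀ L : ℝ, 0 < L → ENNReal.ofReal L * volume {θ ∈ Set.Ioc 0 (2 * π) |
      ∃ r ∈ Set.Ico (0:ℝ) 1, 8 * L < (w (circlePt r θ)).re} ≤ C := by
    intro L hL
    set ρ : ℕ → ℝ := fun n => 1 - 1 / ((n:ℝ) + 2) with hρ
    have hρ0 : ∀ n, 0 < ρ n := by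
      intro n
      have : 1 / ((n:ℝ) + 2) < 1 := by rw [div_lt_one (by positivity)]; linarith [n.cast_nonneg (α := ℝ)]
      simp only [hρ]; linarith
    have hρ1 : ∀ n, ρ n < 1 := by
      intro n
      have : 0 < 1 / ((n:ℝ) + 2) := by positivity
      simp only [hρ]; linarith
    have hρm : Monotone ρ := by
      intro m n hmn
      simp only [hρ]
      gcongr
    have hρt : Tendsto ρ atTop (𝓝 1) := by
      have h1 : Tendsto (fun n : ℕ => 1 / ((n:ℝ) + 2)) atTop (𝓝 0) := by
        apply Tendsto.div_atTop tendsto_const_nhds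
        exact tendsto_atTop_add_const_right _ _ tendsto_natCast_atTop_atTop
      simpa [hρ] using (tendsto_const_nhds (x := (1:ℝ))).sub h1
    set T : ℕ → Set ℝ := fun n => {θ ∈ Set.Ioc 0 (2 * π) |
      ∃ s ∈ Set.Ico (0:ℝ) (ρ n), 8 * L < (w (circlePt s θ)).re} with hT
    have hTm : Monotone T := by
      rintro m n hmn θ ⟨hθ, s, hs, h⟩
      exact ⟨hθ, s, ⟨hs.1, hs.2.trans_le (hρm hmn)⟩, h⟩
    have hTU : {θ ∈ Set.Ioc 0 (2 * π) |
      ∃ r ∈ Set.Ico (0:ℝ) 1, 8 * L < (w (circlePt r θ)).re} ⊆ ⋃ n, T n := by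
      rintro θ ⟨hθ, s, hs, h⟩
      obtain ⟨n, hn⟩ := (hρt.eventually (lt_mem_nhds hs.2)).exists
      exact mem_iUnion.2 ⟨n, hθ, s, ⟨hs.1, hn⟩, h⟩
    refine (mul_le_mul_right (measure_mono hTU) _).trans ?_
    rw [hTm.measure_iUnion, ENNReal.mul_iSup]
    refine iSup_le fun n => ?_
    have hsub : ∀ z ∈ Metric.closedBall (0:ℂ) 1, (ρ n : ℂ) * z ∈ Metric.ball (0:ℂ) 1 := by
      intro z hz
      rw [mem_closedBall_zero_iff] at hz
      rw [mem_ball_zero_iff, norm_mul, Complex.norm_real, Real.norm_eq_abs, abs_of_pos (hρ0 n)]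
      nlinarith [hρ0 n, hρ1 n]
    have h2 := re_weak_closed (fun z => w ((ρ n : ℂ) * z)) ?_ ?_ L hL
    · simp only [mul_zero] at h2
      refine le_trans ?_ h2
      refine mul_le_mul_right (measure_mono ?_) _
      rintro θ ⟨hθ, s, hs, h⟩
      refine ⟨hθ, ?_⟩
      refine ⟨s / ρ n, ⟨div_nonneg hs.1 (hρ0 n).le, (div_lt_one (hρ0 n)).2 hs.2⟩, ?_⟩
      have : (ρ n : ℂ) * circlePt (s / ρ n) θ = circlePt s θ := by
        have : (ρ n : ℂ) ≠ 0 := Complex.ofReal_ne_zero.2 (hρ0 n).ne'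
        simp only [circlePt]
        push_cast
        field_simp
      rw [this]; exact h
    · intro z hz
      have h3 : AnalyticAt ℂ w ((ρ n : ℂ) * z) :=
        (hw.analyticOnNhd Metric.isOpen_ball) _ (hsub z hz)
      exact AnalyticAt.fun_comp h3 (by fun_prop)
    · intro z hz
      exact hpos _ (hsub z hz)
  rw [ae_restrict_iff' measurableSet_Ioc, ae_iff]
  set N := {θ | ¬(θ ∈ Set.Ioc 0 (2 * π) → ∃ B : ℝ, ∀ r ∈ Set.Ico (0:ℝ) 1,
      (w (circlePt r θ)).re ≤ B)}
  have hN : ∀ L : ℝ, 0 < L → ENNReal.ofReal L * volume N ≤ C := by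
    intro L hL
    refine le_trans ?_ (hS L hL)
    gcongr
    intro θ hθ
    simp only [N, mem_ofPred_eq] at hθ
    push Not at hθ
    exact ⟨hθ.1, hθ.2 (8 * L)⟩
  by_contra hne
  have h1 : ∀ n : ℕ, (n : ℝ≥0∞) * volume N ≤ C := by
    intro n
    rcases Nat.eq_zero_or_pos n with h | h
    · simp [h]
    · have := hN n (by exact_mod_cast h)
      simpa using this
  obtain ⟨n, hn⟩ := ENNReal.exists_nat_mul_gt hne hCtop
  exact absurd (h1 n) (not_le.2 hn)

lemma posre_ae_bdd (g : ℂ → ℂ) (hg : DifferentiableOn ℂ g (Metric.ball 0 1))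
    (hpos : ∀ z ∈ Metric.ball (0:ℂ) 1, 0 < (g z).re) :
    ∀ᵐ θ ∂(volume.restrict (Set.Ioc 0 (2 * π))), ∃ B : ℝ, ∀ r ∈ Set.Ico (0:ℝ) 1,
      ‖g (circlePt r θ)‖ ≤ B := by
  set w : ℂ → ℂ := fun z => Complex.exp (Complex.log (g z) / 2) with hw
  have hwsq : ∀ z ∈ Metric.ball (0:ℂ) 1, w z ^ 2 = g z := by
    intro z hz
    have h0 : g z ≠ 0 := by
      intro h; have := hpos z hz; rw [h] at this; simp at this
    simp only [hw]
    rw [← Complex.exp_nat_mul]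
    push_cast
    rw [mul_div_cancel₀ _ (by norm_num), Complex.exp_log h0]
  have hwre : ∀ z, 0 ≤ (w z).re := by
    intro z
    simp only [hw]
    rw [Complex.exp_re]
    apply mul_nonneg (Real.exp_pos _).le
    apply Real.cos_nonneg_of_mem_Icc
    have h1 := Complex.neg_pi_lt_arg (g z)
    have h2 := Complex.arg_le_pi (g z)
    have : (Complex.log (g z) / 2).im = Complex.arg (g z) / 2 := by
      rw [show (2:ℂ) = ((2:ℝ):ℂ) by norm_num, Complex.div_ofReal_im, Complex.log_im]
    rw [this]
    constructor <;> linarith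
  have hbd : ∀ z ∈ Metric.ball (0:ℂ) 1, ‖g z‖ ≤ 2 * (w z).re ^ 2 := by
    intro z hz
    have h1 := hpos z hz
    rw [← hwsq z hz] at h1 ⊢
    rw [norm_pow, ← Complex.normSq_eq_norm_sq, Complex.normSq_apply]
    rw [pow_two, Complex.mul_re] at h1
    nlinarith
  have hwd : DifferentiableOn ℂ w (Metric.ball 0 1) := by
    refine DifferentiableOn.cexp (DifferentiableOn.div_const ?_ _)
    exact hg.clog fun z hz => Or.inl (hpos z hz)
  filter_upwards [re_ae_bdd w hwd fun z _ => hwre z] with θ ⟨B, hB⟩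
  refine ⟨2 * B ^ 2, fun r hr => ?_⟩
  refine (hbd _ (circlePt_mem r θ hr)).trans ?_
  have h1 := hB r hr
  have h2 := hwre (circlePt r θ)
  gcongr
lemma exists_holo_log (F : ℂ → ℂ) (hF : DifferentiableOn ℂ F (Metric.ball 0 1))
    (hFz : ∀ z ∈ Metric.ball (0:ℂ) 1, F z ≠ 0) :
    ∃ h : ℂ → ℂ, DifferentiableOn ℂ h (Metric.ball 0 1) ∧
      ∀ z ∈ Metric.ball (0:ℂ) 1, Complex.exp (h z) = F z := by
  have hd : DifferentiableOn ℂ (fun z => deriv F z / F z) (Metric.ball 0 1) :=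
    (hF.deriv Metric.isOpen_ball).div hF hFz
  obtain ⟨H, hH⟩ := hd.isExactOn_ball.with_val_at 0 (Complex.log (F 0))
  have h0 : (0:ℂ) ∈ Metric.ball (0:ℂ) 1 := by simp
  have hHd : ∀ z ∈ Metric.ball (0:ℂ) 1, HasDerivAt H (deriv F z / F z) z := hH.2
  have hH0 : H 0 = Complex.log (F 0) := hH.1
  refine ⟨H, fun z hz => (hHd z hz).differentiableAt.differentiableWithinAt, ?_⟩
  have hconst : ∀ z ∈ Metric.ball (0:ℂ) 1,
      Complex.exp (-H z) * F z = Complex.exp (-H 0) * F 0 := by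
    intro z hz
    refine Metric.isOpen_ball.is_const_of_deriv_eq_zero (f := fun z => Complex.exp (-H z) * F z)
      (convex_ball (0:ℂ) 1).isPreconnected ?_ ?_ hz h0
    · intro z hz
      exact ((hHd z hz).neg.cexp.differentiableAt.differentiableWithinAt).mul (hF z hz)
    · intro z hz
      have h1 : HasDerivAt F (deriv F z) z :=
        (hF.differentiableAt (Metric.isOpen_ball.mem_nhds hz)).hasDerivAt
      have h2 := (hHd z hz).neg.cexp.mul h1
      refine h2.deriv.trans ?_
      have := hFz z hz
      simp only [Pi.neg_apply, Pi.zero_apply]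
      field_simp
      ring
  intro z hz
  have h1 := hconst z hz
  rw [hH0, Complex.exp_neg, Complex.exp_neg, Complex.exp_log (hFz 0 h0),
    inv_mul_cancel₀ (hFz 0 h0)] at h1
  have h2 := Complex.exp_ne_zero (H z)
  field_simp at h1
  exact h1.symm

lemma exists_majorant (h : ℂ → ℂ) (hh : DifferentiableOn ℂ h (Metric.ball 0 1)) (Φ : ℂ → ℝ)
    (hΦ : CircleIntegrable Φ 0 1) (hΦ0 : ∀ z, 0 ≤ Φ z)
    (hle : ∀ᵐ θ ∂(volume.restrict (Set.Ioc 0 (2 * π))), ∀ r ∈ Set.Ico (0:ℝ) 1,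
      (h (circlePt r θ)).re ≤ Φ (circleMap 0 1 θ)) :
    ∃ K : ℂ → ℂ, DifferentiableOn ℂ K (Metric.ball 0 1) ∧
      (∀ z ∈ Metric.ball (0:ℂ) 1, 0 < (K z).re) ∧
      ∀ z ∈ Metric.ball (0:ℂ) 1, 0 < (K z - h z).re := by
  have hΦc : CircleIntegrable (fun ζ => (Φ ζ : ℂ)) 0 1 := by
    simp only [CircleIntegrable, intervalIntegrable_iff] at hΦ ⊢
    exact Complex.ofRealCLM.integrable_comp hΦ
  have hpt : ∀ z ∈ Metric.ball (0:ℂ) 1, ∃ r θ, r ∈ Set.Ico (0:ℝ) 1 ∧ z = circlePt r θ := by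
    intro z hz
    refine ⟨‖z‖, z.arg, ⟨norm_nonneg _, by simpa using hz⟩, ?_⟩
    simp [circlePt]
  set K0 : ℂ → ℂ := fun w => Real.circleAverage
    (fun ζ => herglotzRieszKernel 0 w ζ • (Φ ζ : ℂ)) 0 1 with hK0
  have hK0re : ∀ z ∈ Metric.ball (0:ℂ) 1,
      (K0 z).re = Real.circleAverage (poissonKernel 0 z • Φ) 0 1 := by
    intro z hz
    rw [poissonKernel_eq_re_herglotzRieszKernel]
    exact re_circleAverage_herglotzRieszKernel_smul hΦ hz
  have hpos : ∀ z ∈ Metric.ball (0:ℂ) 1, ∀ t, 0 ≤ poissonKernel 0 z (circleMap 0 1 t) := by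
    intro z hz t
    obtain ⟨r, θ, hr, rfl⟩ := hpt z hz
    exact poissonKernel_nonneg_aux r θ t hr
  have hPc : ∀ z ∈ Metric.ball (0:ℂ) 1,
      Continuous fun t => poissonKernel 0 z (circleMap 0 1 t) := by
    intro z hz
    obtain ⟨r, θ, hr, rfl⟩ := hpt z hz
    exact continuous_poisson_aux r θ hr
  have hPi : ∀ z ∈ Metric.ball (0:ℂ) 1, IntervalIntegrable
      (fun t => poissonKernel 0 z (circleMap 0 1 t) * Φ (circleMap 0 1 t)) volume 0 (2 * π) := by
    intro z hz
    exact IntervalIntegrable.continuousOn_mul hΦ (hPc z hz).continuousOn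
  have h2π : (0:ℝ) ≤ 2 * π := by positivity
  have hge : ∀ z ∈ Metric.ball (0:ℂ) 1, (h z).re ≤ (K0 z).re := by
    intro z hz
    have hstep : ∀ ρ ∈ Set.Ioo (0:ℝ) 1, (h ((ρ:ℂ) * z)).re ≤ (K0 z).re := by
      intro ρ hρ
      have hsub : ∀ z ∈ Metric.closedBall (0:ℂ) 1, (ρ : ℂ) * z ∈ Metric.ball (0:ℂ) 1 := by
        intro z hz
        rw [mem_closedBall_zero_iff] at hz
        rw [mem_ball_zero_iff, norm_mul, Complex.norm_real, Real.norm_eq_abs, abs_of_pos hρ.1]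
        nlinarith [hρ.1, hρ.2]
      have han : ∀ z ∈ Metric.closedBall (0:ℂ) 1, AnalyticAt ℂ (fun z => h ((ρ:ℂ) * z)) z := by
        intro z hz
        have h3 : AnalyticAt ℂ h ((ρ : ℂ) * z) :=
          (hh.analyticOnNhd Metric.isOpen_ball) _ (hsub z hz)
        exact AnalyticAt.fun_comp h3 (by fun_prop)
      have hharm : InnerProductSpace.HarmonicOnNhd (fun z => (h ((ρ:ℂ) * z)).re)
          (Metric.closedBall (0:ℂ) 1) := fun z hz => (han z hz).harmonicAt_re
      have h1 := hharm.circleAverage_poissonKernel_smul hz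
      rw [hK0re z hz, ← h1, Real.circleAverage_def, Real.circleAverage_def]
      refine smul_le_smul_of_nonneg_left ?_ (by positivity)
      have hcv : Continuous fun t => (h ((ρ:ℂ) * (circleMap 0 1 t))).re := by
        apply Complex.continuous_re.comp
        rw [continuous_iff_continuousAt]
        intro t
        exact ((han (circleMap 0 1 t) (by simp)).continuousAt).comp
          (f := fun t => circleMap 0 1 t) (continuous_circleMap 0 1).continuousAt
      refine intervalIntegral.integral_mono_ae_restrict h2π
        (((hPc z hz).mul hcv).intervalIntegrable _ _) (hPi z hz) ?_
      rw [Filter.EventuallyLE, ← restrict_Ioc_eq_restrict_Icc]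
      filter_upwards [hle] with t ht
      have h4 := ht ρ ⟨hρ.1.le, hρ.2⟩
      have h5 : circlePt ρ t = (ρ:ℂ) * circleMap 0 1 t := by simp [circlePt, circleMap]
      rw [h5] at h4
      exact mul_le_mul_of_nonneg_left h4 (hpos z hz t)
    have hlim : Tendsto (fun ρ : ℝ => (h ((ρ:ℂ) * z)).re) (𝓝[<] 1) (𝓝 (h z).re) := by
      have hc : ContinuousAt h z := (hh.differentiableAt (Metric.isOpen_ball.mem_nhds hz)).continuousAt
      have h1 : Tendsto (fun ρ : ℝ => (ρ:ℂ) * z) (𝓝[<] 1) (𝓝 z) := by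
        have : Continuous (fun ρ : ℝ => (ρ:ℂ) * z) := by fun_prop
        have := this.tendsto 1
        simp only [Complex.ofReal_one, one_mul] at this
        exact this.mono_left nhdsWithin_le_nhds
      exact (Complex.continuous_re.tendsto _).comp (hc.tendsto.comp h1)
    refine le_of_tendsto hlim ?_
    filter_upwards [Ioo_mem_nhdsLT (show (0:ℝ) < 1 by norm_num)] with ρ hρ using hstep ρ hρ
  have hK0pos : ∀ z ∈ Metric.ball (0:ℂ) 1, 0 ≤ (K0 z).re := by
    intro z hz
    rw [hK0re z hz, Real.circleAverage_def]
    refine smul_nonneg (by positivity) ?_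
    exact intervalIntegral.integral_nonneg h2π fun t _ => mul_nonneg (hpos z hz t) (hΦ0 _)
  refine ⟨fun z => K0 z + 1, ?_, ?_, ?_⟩
  · exact (differentiableOn_circleAverage_herglotzRieszKernel_smul hΦc).add_const _
  · intro z hz
    have := hK0pos z hz
    simp; linarith
  · intro z hz
    have := hge z hz
    simp; linarith

lemma log_ae_bdd (h : ℂ → ℂ) (hh : DifferentiableOn ℂ h (Metric.ball 0 1)) (Φ : ℂ → ℝ)
    (hΦ : CircleIntegrable Φ 0 1) (hΦ0 : ∀ z, 0 ≤ Φ z)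
    (hle : ∀ᵐ θ ∂(volume.restrict (Set.Ioc 0 (2 * π))), ∀ r ∈ Set.Ico (0:ℝ) 1,
      (h (circlePt r θ)).re ≤ Φ (circleMap 0 1 θ)) :
    ∀ᵐ θ ∂(volume.restrict (Set.Ioc 0 (2 * π))), ∃ B : ℝ, ∀ r ∈ Set.Ico (0:ℝ) 1,
      ‖h (circlePt r θ)‖ ≤ B := by
  obtain ⟨K, hK, hK1, hK2⟩ := exists_majorant h hh Φ hΦ hΦ0 hle
  filter_upwards [posre_ae_bdd K hK hK1, posre_ae_bdd (fun z => K z - h z) (hK.sub hh) hK2]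
    with θ ⟨B1, h1⟩ ⟨B2, h2⟩
  refine ⟨B1 + B2, fun r hr => ?_⟩
  have := norm_sub_le (K (circlePt r θ)) (K (circlePt r θ) - h (circlePt r θ))
  rw [sub_sub_cancel] at this
  linarith [h1 r hr, h2 r hr]
lemma measurable_maxRad (f : ℂ → ℂ) (hf : DifferentiableOn ℂ f unitDisk) :
    Measurable (maxRad f) := by
  apply LowerSemicontinuous.measurable
  unfold maxRad
  refine lowerSemicontinuous_biSup fun r hr => Continuous.lowerSemicontinuous ?_
  refine ENNReal.continuous_coe.comp (continuous_nnnorm.comp ?_)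
  refine hf.continuousOn.comp_continuous (f := fun θ => circlePt r θ) ?_ ?_
  · unfold circlePt; fun_prop
  · intro θ; exact circlePt_mem r θ hr

lemma measurable_elogPlus : Measurable elogPlus := by
  unfold elogPlus
  refine Measurable.ite (measurableSet_singleton _) measurable_const ?_
  exact ENNReal.measurable_ofReal.comp (Real.measurable_log.comp ENNReal.measurable_toReal)

lemma measurable_elog1p : Measurable elog1p := by
  unfold elog1p
  refine Measurable.ite (measurableSet_singleton _) measurable_const ?_
  exact ENNReal.measurable_ofReal.comp
    (Real.measurable_log.comp (measurable_const.add ENNReal.measurable_toReal))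

lemma elogPlus_le (x y : ℝ≥0∞) (h : x ≤ max 1 y) : elogPlus x ≤ elogPlus y := by
  by_cases hy : y = ∞
  · simp [elogPlus, hy]
  have hx : x ≠ ∞ := ne_top_of_le_ne_top (by simp [hy]) h
  simp only [elogPlus, hx, hy, if_false]
  have hle1 : x ≤ 1 → ENNReal.ofReal (Real.log x.toReal) ≤ ENNReal.ofReal (Real.log y.toReal) := by
    intro h1
    rw [ENNReal.ofReal_of_nonpos]
    · exact zero_le
    · apply Real.log_nonpos ENNReal.toReal_nonneg
      exact ENNReal.toReal_le_of_le_ofReal (by norm_num) (by simpa using h1)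
  rcases le_total x 1 with h1 | h1
  · exact hle1 h1
  · rcases le_max_iff.1 h with h4 | h4
    · exact hle1 h4
    · apply ENNReal.ofReal_le_ofReal
      have h3 : (1:ℝ) ≤ x.toReal := by
        have := ENNReal.toReal_mono hx h1
        simpa using this
      exact Real.log_le_log (by linarith) (ENNReal.toReal_mono hy h4)

lemma elog1p_le_self (x : ℝ≥0∞) : elog1p x ≤ x := by
  by_cases hx : x = ∞
  · simp [hx]
  simp only [elog1p, hx, if_false]
  refine ENNReal.ofReal_le_of_le_toReal ?_
  have h0 : 0 ≤ x.toReal := ENNReal.toReal_nonneg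
  have := Real.log_le_sub_one_of_pos (show 0 < 1 + x.toReal by linarith)
  linarith

lemma elog1p_le (a b c : ℝ≥0∞) (h : c ≤ a * (1 + max 1 b)) :
    elog1p c ≤ ENNReal.ofReal (Real.log 3) + elogPlus a + elogPlus b := by
  by_cases ha : a = ∞
  · simp [elogPlus, ha]
  by_cases hb : b = ∞
  · simp [elogPlus, hb]
  have hr : a * (1 + max 1 b) ≠ ∞ := by
    refine ENNReal.mul_ne_top ha (ENNReal.add_ne_top.2 ⟨by simp, by simp [hb]⟩)
  have hc : c ≠ ∞ := ne_top_of_le_ne_top hr h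
  lift a to ℝ≥0 using ha
  lift b to ℝ≥0 using hb
  lift c to ℝ≥0 using hc
  have h' : (c : ℝ) ≤ a * (1 + max 1 (b:ℝ)) := by exact_mod_cast h
  have key : ∀ x : ℝ≥0, Real.log (max 1 (x:ℝ)) ≤ max 0 (Real.log x) := by
    intro x
    rcases le_total (1:ℝ) x with h | h
    · rw [max_eq_right h]; exact le_max_right _ _
    · rw [max_eq_left h]; simp
  simp only [elog1p, elogPlus, ENNReal.coe_ne_top, if_false, ENNReal.coe_toReal]
  have h3 : Real.log (1 + c) ≤ Real.log 3 + max 0 (Real.log a) + max 0 (Real.log b) := by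
    have h4 : 1 + (c:ℝ) ≤ 3 * max 1 (a:ℝ) * max 1 (b:ℝ) := by
      have e1 := le_max_left 1 (a:ℝ)
      have e2 := le_max_right 1 (a:ℝ)
      have e3 := le_max_left 1 (b:ℝ)
      have : (a:ℝ) * (1 + max 1 (b:ℝ)) ≤ max 1 (a:ℝ) * (1 + max 1 (b:ℝ)) := by gcongr
      nlinarith
    have h5 : Real.log (1 + c) ≤ Real.log (3 * max 1 (a:ℝ) * max 1 (b:ℝ)) :=
      Real.log_le_log (by positivity) h4
    rw [Real.log_mul (by positivity) (by positivity), Real.log_mul (by norm_num) (by positivity)]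
      at h5
    linarith [key a, key b]
  have hm : ∀ x : ℝ, ENNReal.ofReal (max 0 x) = ENNReal.ofReal x := by
    intro x
    rcases le_total 0 x with h | h
    · rw [max_eq_right h]
    · rw [max_eq_left h, ENNReal.ofReal_of_nonpos h]; simp
  refine (ENNReal.ofReal_le_ofReal h3).trans ?_
  rw [← hm (Real.log a), ← hm (Real.log b)]
  exact ENNReal.ofReal_add_le.trans (by gcongr; exact ENNReal.ofReal_add_le)

lemma mp_lintegral_ne_top {p : ℝ} {f : ℂ → ℂ} (hf : f ∈ MpClass p) :
    ∫⁻ θ in Set.Ioc 0 (2 * π), elogPlus (maxRad f θ) ^ p ≠ ∞ := by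
  intro h
  have h2 := hf.2
  rw [h, ENNReal.top_div_of_ne_top ENNReal.ofReal_ne_top] at h2
  exact lt_irrefl _ h2

lemma mp_of_le {p : ℝ} (hp : 1 < p) {f F : ℂ → ℂ} (hF : F ∈ MpClass p)
    (hf : DifferentiableOn ℂ f unitDisk) (hle : ∀ z ∈ unitDisk, ‖f z‖ ≤ max 1 ‖F z‖) :
    f ∈ MpClass p := by
  refine ⟨hf, lt_of_le_of_lt ?_ hF.2⟩
  gcongr with θ
  apply elogPlus_le
  refine iSup₂_le fun r hr => ?_
  have h1 := hle _ (circlePt_mem r θ hr)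
  have h2 : (‖f (circlePt r θ)‖₊ : ℝ≥0∞) ≤ max 1 (‖F (circlePt r θ)‖₊ : ℝ≥0∞) := by
    exact_mod_cast h1
  refine h2.trans (max_le_max le_rfl ?_)
  exact le_iSup₂ (f := fun r (_ : r ∈ Set.Ico (0:ℝ) 1) => (‖F (circlePt r θ)‖₊ : ℝ≥0∞)) r hr

lemma maxRad_ae_lt_top {p : ℝ} (hp : 1 < p) {f : ℂ → ℂ} (hf : f ∈ MpClass p) :
    ∀ᵐ θ ∂(volume.restrict (Set.Ioc 0 (2 * π))), maxRad f θ ≠ ∞ := by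
  have hm : Measurable fun θ => elogPlus (maxRad f θ) ^ p :=
    (measurable_elogPlus.comp (measurable_maxRad f hf.1)).pow_const p
  filter_upwards [ae_lt_top hm (mp_lintegral_ne_top hf)] with θ hθ h
  simp [elogPlus, h, ENNReal.top_rpow_of_pos (show 0 < p by linarith)] at hθ

lemma norm_le_maxRad (f : ℂ → ℂ) (r θ : ℝ) (hr : r ∈ Set.Ico (0:ℝ) 1) :
    (‖f (circlePt r θ)‖₊ : ℝ≥0∞) ≤ maxRad f θ :=
  le_iSup₂ (f := fun r (_ : r ∈ Set.Ico (0:ℝ) 1) => (‖f (circlePt r θ)‖₊ : ℝ≥0∞)) r hr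

lemma log_ae_bdd_mp {p : ℝ} (hp : 1 < p) {F h : ℂ → ℂ} (hF : F ∈ MpClass p)
    (hh : DifferentiableOn ℂ h (Metric.ball 0 1))
    (hexp : ∀ z ∈ Metric.ball (0:ℂ) 1, Complex.exp (h z) = F z) :
    ∀ᵐ θ ∂(volume.restrict (Set.Ioc 0 (2 * π))), ∃ B : ℝ, ∀ r ∈ Set.Ico (0:ℝ) 1,
      ‖h (circlePt r θ)‖ ≤ B := by
  set Φ : ℂ → ℝ := fun ζ =>
    (elogPlus (⨆ r ∈ Set.Ico (0 : ℝ) 1, (‖F ((r:ℂ) * ζ)‖₊ : ℝ≥0∞))).toReal with hΦ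
  have hΦe : ∀ t, Φ (circleMap 0 1 t) = (elogPlus (maxRad F t)).toReal := by
    intro t
    simp [hΦ, maxRad, circlePt, circleMap]
  have hm : Measurable fun θ => elogPlus (maxRad F θ) :=
    measurable_elogPlus.comp (measurable_maxRad F hF.1)
  refine log_ae_bdd h hh Φ ?_ (fun z => ENNReal.toReal_nonneg) ?_
  · unfold CircleIntegrable
    simp only [hΦe]
    rw [intervalIntegrable_iff, uIoc_of_le (by positivity)]
    refine integrable_toReal_of_lintegral_ne_top hm.aemeasurable ?_
    have hle : ∫⁻ θ in Set.Ioc 0 (2 * π), elogPlus (maxRad F θ) ≤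
        ∫⁻ θ in Set.Ioc 0 (2 * π), (1 + elogPlus (maxRad F θ) ^ p) := by
      refine lintegral_mono fun θ => ?_
      rcases le_total (elogPlus (maxRad F θ)) 1 with h1 | h1
      · exact h1.trans le_self_add
      · refine le_trans ?_ le_add_self
        calc elogPlus (maxRad F θ) = elogPlus (maxRad F θ) ^ (1:ℝ) := by simp
          _ ≤ _ := ENNReal.rpow_le_rpow_of_exponent_le h1 hp.le
    refine ne_top_of_le_ne_top ?_ hle
    rw [lintegral_add_left measurable_const]
    refine ENNReal.add_ne_top.2 ⟨?_, mp_lintegral_ne_top hF⟩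
    rw [lintegral_const]
    exact ENNReal.mul_ne_top (by simp) (measure_lt_top _ _).ne
  · filter_upwards [maxRad_ae_lt_top hp hF] with θ hθ r hr
    rw [hΦe]
    have h1 := norm_le_maxRad F r θ hr
    have h2 := ENNReal.toReal_mono hθ h1
    simp only [ENNReal.coe_toReal, coe_nnnorm] at h2
    rw [← hexp _ (circlePt_mem r θ hr), Complex.norm_exp] at h2
    simp only [elogPlus, hθ, if_false]
    rw [ENNReal.toReal_ofReal']
    refine le_trans ?_ (le_max_left _ _)
    rwa [Real.le_log_iff_exp_le (lt_of_lt_of_le (Real.exp_pos _) h2)]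
/-- A prime ideal of `M^p` containing a function which is zero-free on the
unit disk is dense in `(M^p, ρ_p)`. -/
theorem prime_ideal_with_zero_free_is_dense (p : ℝ) (hp : 1 < p)
    (I : Set (ℂ → ℂ)) (hI : IsPrimeIdealIn p I)
    (F : ℂ → ℂ) (hFI : F ∈ I) (hFz : ∀ z ∈ unitDisk, F z ≠ 0) :
    IsDenseIn p I := by
  classical
  obtain ⟨hid, hprime⟩ := hI
  have hF : F ∈ MpClass p := hid.subset hFI
  have hp0 : 0 < p := by linarith
  obtain ⟨h, hh, hexp⟩ := exists_holo_log F hF.1 hFz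
  -- fractional powers of `F`
  set E : ℝ → ℂ → ℂ := fun s => unitDisk.indicator fun z => Complex.exp ((s:ℂ) * h z) with hE
  have hEz : ∀ s, ∀ z ∈ unitDisk, E s z = Complex.exp ((s:ℂ) * h z) := by
    intro s z hz; simp only [hE]; rw [indicator_of_mem hz]
  have hEd : ∀ s, DifferentiableOn ℂ (E s) unitDisk := by
    intro s
    refine DifferentiableOn.congr ?_ (hEz s)
    exact (hh.const_mul _).cexp
  have hEn : ∀ s ∈ Set.Icc (0:ℝ) 1, ∀ z ∈ unitDisk, ‖E s z‖ ≤ max 1 ‖F z‖ := by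
    intro s hs z hz
    rw [hEz s z hz, ← hexp z hz, Complex.norm_exp, Complex.norm_exp, Complex.re_ofReal_mul]
    rcases le_total 0 (h z).re with h1 | h1
    · refine le_trans ?_ (le_max_right _ _)
      gcongr
      nlinarith [hs.2]
    · refine le_trans ?_ (le_max_left _ _)
      rw [Real.exp_le_one_iff]
      exact mul_nonpos_of_nonneg_of_nonpos hs.1 h1
  have hEM : ∀ s ∈ Set.Icc (0:ℝ) 1, E s ∈ MpClass p := fun s hs =>
    mp_of_le hp hF (hEd s) (hEn s hs)
  have hE1 : E 1 ∈ I := by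
    have h1 := hid.mul_mem _ (hEM 0 (by simp)) F hFI
    have h2 : E 0 * F = E 1 := by
      ext z
      by_cases hz : z ∈ unitDisk
      · rw [Pi.mul_apply, hEz _ z hz, hEz _ z hz, ← hexp z hz]; simp
      · simp [hE, hz]
    rwa [h2] at h1
  have hs : ∀ k : ℕ, ((1/2:ℝ)^k) ∈ Set.Icc (0:ℝ) 1 := fun k =>
    ⟨by positivity, pow_le_one₀ (by norm_num) (by norm_num)⟩
  have hEI : ∀ k : ℕ, E ((1/2)^k) ∈ I := by
    intro k
    induction k with
    | zero => simpa using hE1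
    | succ k ih =>
      have h2 : E ((1/2)^(k+1)) * E ((1/2)^(k+1)) = E ((1/2)^k) := by
        ext z
        by_cases hz : z ∈ unitDisk
        · rw [Pi.mul_apply, hEz _ z hz, hEz _ z hz, ← Complex.exp_add]
          congr 1
          push_cast
          ring
        · simp [hE, hz]
      rw [← h2] at ih
      rcases hprime _ (hEM _ (hs _)) _ (hEM _ (hs _)) ih with h | h <;> exact h
  intro f hf ε hε
  set G : ℕ → ℂ → ℂ := fun k => f * E ((1/2)^k) with hG
  have hGI : ∀ k, G k ∈ I := fun k => hid.mul_mem f hf _ (hEI k)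
  have hGd : ∀ k, DifferentiableOn ℂ (f - G k) unitDisk := fun k =>
    hf.1.sub (hf.1.mul (hEd _))
  have hGz : ∀ k, ∀ z ∈ unitDisk,
      (f - G k) z = f z * (1 - Complex.exp ((((1/2:ℝ)^k : ℝ):ℂ) * h z)) := by
    intro k z hz
    simp only [hG, Pi.sub_apply, Pi.mul_apply]
    rw [hEz _ z hz]; ring
  -- dominated convergence
  have hdom : ∀ k θ, elog1p (maxRad (f - G k) θ) ≤
      ENNReal.ofReal (Real.log 3) + elogPlus (maxRad f θ) + elogPlus (maxRad F θ) := by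
    intro k θ
    apply elog1p_le
    refine iSup₂_le fun r hr => ?_
    have hz := circlePt_mem r θ hr
    have h1 : ‖(f - G k) (circlePt r θ)‖ ≤
        ‖f (circlePt r θ)‖ * (1 + max 1 ‖F (circlePt r θ)‖) := by
      rw [hGz k _ hz, norm_mul]
      gcongr
      refine (norm_sub_le _ _).trans ?_
      rw [norm_one, ← hEz _ _ hz]
      gcongr
      exact hEn _ (hs k) _ hz
    have h2 : (‖(f - G k) (circlePt r θ)‖₊ : ℝ≥0∞) ≤
        (‖f (circlePt r θ)‖₊ : ℝ≥0∞) * (1 + max 1 (‖F (circlePt r θ)‖₊ : ℝ≥0∞)) := by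
      exact_mod_cast h1
    refine h2.trans ?_
    gcongr
    · exact norm_le_maxRad f r θ hr
    · exact norm_le_maxRad F r θ hr
  have hmf := measurable_elogPlus.comp (measurable_maxRad f hf.1)
  have hmF := measurable_elogPlus.comp (measurable_maxRad F hF.1)
  have hbound : ∫⁻ θ in Set.Ioc 0 (2 * π), (ENNReal.ofReal (Real.log 3) + elogPlus (maxRad f θ)
      + elogPlus (maxRad F θ)) ^ p ≠ ∞ := by
    have h1 : ∀ θ, (ENNReal.ofReal (Real.log 3) + elogPlus (maxRad f θ)
      + elogPlus (maxRad F θ)) ^ p ≤ 2 ^ (p - 1) * (2 ^ (p - 1) *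
        (ENNReal.ofReal (Real.log 3) ^ p + elogPlus (maxRad f θ) ^ p)
          + elogPlus (maxRad F θ) ^ p) := by
      intro θ
      refine (ENNReal.rpow_add_le_mul_rpow_add_rpow _ _ hp.le).trans ?_
      gcongr
      exact ENNReal.rpow_add_le_mul_rpow_add_rpow _ _ hp.le
    refine ne_top_of_le_ne_top ?_ (lintegral_mono h1)
    have h2t : (2:ℝ≥0∞) ^ (p - 1) ≠ ∞ := ENNReal.rpow_ne_top_of_nonneg (by linarith) (by simp)
    have hmf' : Measurable fun θ => elogPlus (maxRad f θ) ^ p := hmf.pow_const p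
    have hmF' : Measurable fun θ => elogPlus (maxRad F θ) ^ p := hmF.pow_const p
    rw [lintegral_const_mul' _ _ h2t, lintegral_add_right _ hmF', lintegral_const_mul' _ _ h2t,
      lintegral_add_right _ hmf']
    refine ENNReal.mul_ne_top h2t (ENNReal.add_ne_top.2 ⟨ENNReal.mul_ne_top h2t
      (ENNReal.add_ne_top.2 ⟨?_, mp_lintegral_ne_top hf⟩), mp_lintegral_ne_top hF⟩)
    rw [lintegral_const]
    refine ENNReal.mul_ne_top (ENNReal.rpow_ne_top_of_nonneg hp0.le (by simp)) (measure_lt_top _ _).ne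
  have hlim : Tendsto (fun k => ∫⁻ θ in Set.Ioc 0 (2 * π), elog1p (maxRad (f - G k) θ) ^ p)
      atTop (𝓝 (∫⁻ θ in Set.Ioc 0 (2 * π), (0:ℝ≥0∞))) := by
    refine tendsto_lintegral_of_dominated_convergence _ (fun k => ?_) (fun k => ?_) hbound ?_
    · exact (measurable_elog1p.comp (measurable_maxRad _ (hGd k))).pow_const p
    · refine ae_of_all _ fun θ => ?_
      dsimp only
      gcongr
      exact hdom k θ
    · filter_upwards [log_ae_bdd_mp hp hF hh hexp, maxRad_ae_lt_top hp hf] with θ ⟨B, hB⟩ hfin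
      have hB0 : 0 ≤ B := (norm_nonneg _).trans (hB 0 (by simp))
      have hs0 : Tendsto (fun k : ℕ => (1/2:ℝ)^k) atTop (𝓝 0) :=
        tendsto_pow_atTop_nhds_zero_of_lt_one (by norm_num) (by norm_num)
      have hsB : Tendsto (fun k : ℕ => (1/2:ℝ)^k * B) atTop (𝓝 0) := by
        simpa using hs0.mul_const B
      have hub : Tendsto (fun k : ℕ => (maxRad f θ * ENNReal.ofReal (2 * ((1/2:ℝ)^k * B))) ^ p)
          atTop (𝓝 0) := by
        have h1 : Tendsto (fun k : ℕ => ENNReal.ofReal (2 * ((1/2:ℝ)^k * B))) atTop (𝓝 0) := by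
          have := ENNReal.tendsto_ofReal (hsB.const_mul 2)
          simpa using this
        have h2 := ENNReal.Tendsto.const_mul h1 (Or.inr hfin)
        have h3 := ((ENNReal.continuous_rpow_const (y := p)).tendsto _).comp h2
        rw [mul_zero, ENNReal.zero_rpow_of_pos hp0] at h3
        exact h3
      refine tendsto_of_tendsto_of_tendsto_of_le_of_le' tendsto_const_nhds hub
        (Eventually.of_forall fun _ => zero_le) ?_
      filter_upwards [hsB.eventually (gt_mem_nhds (show (0:ℝ) < 1 by norm_num))] with k hk
      gcongr
      refine (elog1p_le_self _).trans ?_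
      refine iSup₂_le fun r hr => ?_
      have hz := circlePt_mem r θ hr
      have hn : ‖(((1/2:ℝ)^k : ℝ):ℂ) * h (circlePt r θ)‖ ≤ (1/2:ℝ)^k * B := by
        rw [norm_mul, Complex.norm_real, Real.norm_eq_abs, abs_of_nonneg (by positivity)]
        gcongr
        exact hB r hr
      have h1 : ‖1 - Complex.exp ((((1/2:ℝ)^k : ℝ):ℂ) * h (circlePt r θ))‖ ≤
          2 * ((1/2:ℝ)^k * B) := by
        rw [norm_sub_rev]
        refine (Complex.norm_exp_sub_one_le (hn.trans hk.le)).trans ?_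
        gcongr
      rw [hGz k _ hz, nnnorm_mul, ENNReal.coe_mul]
      gcongr
      · exact norm_le_maxRad f r θ hr
      · rw [← enorm_eq_nnnorm, ← ofReal_norm]
        exact ENNReal.ofReal_le_ofReal h1
  rw [lintegral_zero] at hlim
  have hrho : Tendsto (fun k => rhoMetric p f (G k)) atTop (𝓝 0) := by
    unfold rhoMetric
    have h1 := ENNReal.Tendsto.div_const hlim (b := ENNReal.ofReal (2 * π))
      (Or.inr (by simp [Real.pi_pos]))
    have h3 := ((ENNReal.continuous_rpow_const (y := 1 / p)).tendsto _).comp h1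
    rw [ENNReal.zero_div, ENNReal.zero_rpow_of_pos (by positivity)] at h3
    exact h3
  obtain ⟨k, hk⟩ := (hrho.eventually (gt_mem_nhds hε)).exists
  exact ⟨G k, hGI k, hk⟩
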